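/- Let α ∈ (g,1], m ∈ ℕ and ε ∈ {−1,1}, and write α^ε − 1 for α − 1 if ε = 1 and for 1/α − 1 if ε = −1. Suppose T_α^n(α−1) ≤ 1/(α+1) and T_α^n(1/α − 1) ≤ 1/(α+1) for all 0 ≤ n < m, and T_α^m(α^ε − 1) > 1/(α+1). Then α belongs to a matching interval J such that: (i) the matching exponents of J are M = m + 2 − (1−ε)/2 and N = m + 2 + (1−ε)/2; (ii) for every α' ∈ J, T_{α'}^n(α'−1) ≤ 1/(α'+1) and T_{α'}^n(1/α' − 1) ≤ 1/(α'+1) for all 0 ≤ n < m and T_{α'}^m(α'^ε − 1) > 1/(α'+1), and in particular 𝓔̃ ∩ J = ∅; (iii) the endpoints α₁, α₂ of J satisfy T_{α₁}^m(α₁^ε − 1) = 1/(α₁+1) and lim_{z ∈ J, z → α₂} T_z^m(z^ε − 1) = α₂; (iv) for every α' ∈ J, T_{α'}^n(α') ≠ α' − 1 for all 1 ≤ n < N and T_{α'}^n(α'−1) ≠ α' − 1 for all 1 ≤ n < M. -/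

import Mathlib

open Set Filter MeasureTheory

/-- The Tanaka–Ito `α`-continued fraction map. -/
noncomputable def T (α x : ℝ) : ℝ := if x = 0 then 0 else 1 / x - (⌊1 / x + 1 - α⌋ : ℝ)

/-- The small golden mean `g = (√5 - 1)/2`. -/
noncomputable def g : ℝ := (Real.sqrt 5 - 1) / 2

/-- `J` is a matching interval with matching exponents `(M, N)`. -/
def IsMatchingInterval (J : Set ℝ) (M N : ℕ) : Prop :=
  (∃ a b : ℝ, a < b ∧ J = Set.Ioo a b) ∧ J ⊆ Set.Icc 0 1 ∧
  (∀ α ∈ J, (T α)^[M] (α - 1) = (T α)^[N] α) ∧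
  (∀ᵐ α ∂(volume.restrict J), (T α)^[M - 1] (α - 1) ≠ (T α)^[N - 1] α) ∧
  (∀ J' : Set ℝ, (∃ a b : ℝ, a < b ∧ J' = Set.Ioo a b) → J' ⊆ Set.Icc 0 1 →
    (∀ α ∈ J', (T α)^[M] (α - 1) = (T α)^[N] α) →
    (∀ᵐ α ∂(volume.restrict J'), (T α)^[M - 1] (α - 1) ≠ (T α)^[N - 1] α) →
    J ⊆ J' → J' = J)

/-- The set `𝓔̃` of parameters in `[g,1]` whose orbits stay below `1/(α+1)`. -/
noncomputable def Etilde : Set ℝ :=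
  {α ∈ Set.Icc g 1 | ∀ n ≥ 1,
    (T α)^[n] (α - 1) ≤ 1 / (α + 1) ∧ (T α)^[n] (1 / α - 1) ≤ 1 / (α + 1)}

/-- `α^ε - 1`, i.e. `α - 1` if `ε = 1` and `1/α - 1` if `ε = -1`. -/
noncomputable def epow (ε : ℤ) (α : ℝ) : ℝ := if ε = 1 then α - 1 else 1 / α - 1

/-! ### One step of the map -/

theorem T_of_ne_zero {z x : ℝ} (hx : x ≠ 0) : T z x = Int.fract (1 / x + 1 - z) + z - 1 := by
  rw [T, if_neg hx, Int.fract]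
  ring

theorem T_zero (z : ℝ) : T z 0 = 0 := if_pos rfl

theorem exists_T_eq {z x : ℝ} (hx : x ≠ 0) : ∃ k : ℤ, T z x = 1 / x - k :=
  ⟨_, if_neg hx⟩

theorem T_mem {z : ℝ} (h0 : 0 < z) (h1 : z ≤ 1) (x : ℝ) : z - 1 ≤ T z x ∧ T z x < z := by
  by_cases hx : x = 0
  · subst hx
    rw [T_zero]
    exact ⟨by linarith, h0⟩
  · rw [T_of_ne_zero hx]
    have h2 := Int.fract_nonneg (1 / x + 1 - z)
    have h3 := Int.fract_lt_one (1 / x + 1 - z)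
    exact ⟨by linarith, by linarith⟩

theorem T_eq {z x : ℝ} {k : ℤ} (hx : x ≠ 0) (hl : z - 1 ≤ 1 / x - k) (hu : 1 / x - k < z) :
    T z x = 1 / x - k := by
  rw [T, if_neg hx, (Int.floor_eq_iff (z := k)).2 ⟨by linarith, by linarith⟩]

theorem T_congr {z x y : ℝ} (hx : x ≠ 0) (hy : y ≠ 0) (k : ℤ) (h : 1 / x = 1 / y + k) :
    T z x = T z y := by
  rw [T_of_ne_zero hx, T_of_ne_zero hy, h, ← Int.fract_add_intCast (1 / y + 1 - z) k]
  ring_nf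

/-- The three possible relations between the points of the two critical orbits at equal times. -/
def Linked (z x y : ℝ) : Prop :=
  (x + y + x * y = 0 ∧ x < 1 / (z + 1) ∧ y < 1 / (z + 1)) ∨ x + y = 0 ∨ x + y = 1

theorem Linked.symm {z x y : ℝ} (h : Linked z x y) : Linked z y x := by
  rcases h with ⟨h, hx, hy⟩ | h | h
  · exact Or.inl ⟨by linarith, hy, hx⟩
  · exact Or.inr (Or.inl (by linarith))
  · exact Or.inr (Or.inr (by linarith))

/-- Points whose reciprocals sum to an integer have images with sum `0` or `1`. -/
theorem T_add_T {z x y : ℝ} (hz : 1 / 2 < z) (hz1 : z ≤ 1) (hx : x ≠ 0) (hy : y ≠ 0) (s : ℤ)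
    (h : 1 / x + 1 / y = s) : T z x + T z y = 0 ∨ T z x + T z y = 1 := by
  obtain ⟨k, hk⟩ := exists_T_eq (z := z) hx
  obtain ⟨l, hl⟩ := exists_T_eq (z := z) hy
  have hsum : T z x + T z y = ((s - k - l : ℤ) : ℝ) := by
    push_cast
    linarith
  have h1 := T_mem (by linarith) hz1 x
  have h2 := T_mem (by linarith) hz1 y
  rw [hsum]
  have h3 : (-1 : ℝ) < ((s - k - l : ℤ) : ℝ) := by linarith
  have h4 : ((s - k - l : ℤ) : ℝ) < 2 := by linarith
  have h5 : -1 < s - k - l := by exact_mod_cast h3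
  have h6 : s - k - l < 2 := by exact_mod_cast h4
  have h7 : s - k - l = 0 ∨ s - k - l = 1 := by omega
  rcases h7 with h7 | h7 <;> simp [h7]

theorem T_eq_sub_one {z x : ℝ} (h0 : 0 < z) (h1 : z < 1) (hx : 1 / (z + 1) < x) (hxz : x < z) :
    T z x = 1 / x - 1 := by
  have hz : 0 < z + 1 := by linarith
  have hx0 : 0 < x := lt_trans (by positivity) hx
  have h2 : 1 / x < z + 1 := by
    rw [div_lt_iff₀ hx0]
    rw [div_lt_iff₀ hz] at hx
    linarith
  have h3 : 1 < 1 / x := by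
    rw [lt_div_iff₀ hx0]
    linarith
  have h4 := T_eq (z := z) (k := 1) hx0.ne'
  push_cast at h4
  exact h4 (by linarith) (by linarith)

theorem T_eq_sub_two {z x : ℝ} (h0 : 0 < z) (hg : 1 < z ^ 2 + z) (hx : z / (z + 1) ≤ x)
    (hxz : x ≤ 1 / (z + 1)) : T z x = 1 / x - 2 ∧ T z x < 1 / (z + 1) := by
  have hz : 0 < z + 1 := by linarith
  have hx0 : 0 < x := lt_of_lt_of_le (by positivity) hx
  have h1 : z + 1 ≤ 1 / x := by
    rw [le_div_iff₀ hx0]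
    rw [le_div_iff₀ hz] at hxz
    linarith
  have h2 : 1 / x ≤ 1 / z + 1 := by
    rw [div_le_iff₀ hz] at hx
    rw [div_add_one h0.ne', div_le_div_iff₀ hx0 h0]
    linarith
  have h3 : 1 / z - 1 < 1 / (z + 1) := by
    rw [div_sub_one h0.ne', div_lt_div_iff₀ h0 hz]
    nlinarith
  have h4 : 1 / (z + 1) < z := by
    rw [div_lt_iff₀ hz]
    nlinarith
  have h6 := T_eq (z := z) (k := 2) hx0.ne'
  push_cast at h6
  have h7 := h6 (by linarith) (by linarith)
  exact ⟨h7, by linarith⟩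

theorem Linked.map {z x y : ℝ} (h0 : 1 / 2 < z) (h1 : z ≤ 1) (hg : 1 < z ^ 2 + z)
    (hx : x ≤ 1 / (z + 1)) (hy : y ≤ 1 / (z + 1)) (h : Linked z x y) :
    Linked z (T z x) (T z y) := by
  have hz : 0 < z := by linarith
  rcases h with ⟨h, -, -⟩ | h | h
  · by_cases hx0 : x = 0
    · have hy0 : y = 0 := by simpa [hx0] using h
      simp [hx0, hy0, T_zero, Linked]
    · have hy0 : y ≠ 0 := by
        rintro rfl
        exact hx0 (by simpa using h)
      refine Or.inr (T_add_T h0 h1 hx0 hy0 (-1) ?_)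
      push_cast
      field_simp
      linarith
  · by_cases hx0 : x = 0
    · have hy0 : y = 0 := by simpa [hx0] using h
      simp [hx0, hy0, T_zero, Linked]
    · obtain rfl : y = -x := by linarith
      refine Or.inr (T_add_T h0 h1 hx0 (by simpa using hx0) 0 ?_)
      push_cast
      field_simp
      ring
  · have he : 1 - 1 / (z + 1) = z / (z + 1) := by
      field_simp
      ring
    obtain ⟨hTx, hTx'⟩ := T_eq_sub_two (x := x) hz hg (by linarith) hx
    obtain ⟨hTy, hTy'⟩ := T_eq_sub_two (x := y) hz hg (by linarith) hy
    have hpos : 0 < z / (z + 1) := by positivity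
    have hx0 : x ≠ 0 := by
      intro h'
      linarith
    have hy0 : y ≠ 0 := by
      intro h'
      linarith
    refine Or.inl ⟨?_, hTx', hTy'⟩
    rw [hTx, hTy]
    obtain rfl : y = 1 - x := by linarith
    field_simp
    ring

/-! ### The critical orbits -/

/-- The orbit of `epow δ z` under `T z`. -/
noncomputable def orb (δ : ℤ) (z : ℝ) (n : ℕ) : ℝ := (T z)^[n] (epow δ z)

theorem orb_succ (δ : ℤ) (z : ℝ) (n : ℕ) : orb δ z (n + 1) = T z (orb δ z n) :=
  Function.iterate_succ_apply' _ _ _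

theorem orb_one_zero (z : ℝ) : orb 1 z 0 = z - 1 := by
  simp [orb, epow]

theorem orb_neg_one_zero (z : ℝ) : orb (-1) z 0 = 1 / z - 1 := by
  simp [orb, epow]

theorem orb_add_eq {δ σ : ℤ} {z : ℝ} {n j : ℕ} (h : orb δ z n = orb σ z j) (k : ℕ) :
    orb δ z (n + k) = orb σ z (j + k) := by
  induction k with
  | zero => exact h
  | succ k ih => rw [← add_assoc, ← add_assoc, orb_succ, orb_succ, ih]

/-- The numerical constraints on parameters in `(g, 1)`. -/
structure Admissible (z : ℝ) : Prop where
  half_lt : 1 / 2 < z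
  lt_one : z < 1
  one_lt : 1 < z ^ 2 + z

theorem Admissible.pos {z : ℝ} (hz : Admissible z) : 0 < z := by linarith [hz.half_lt]

theorem Admissible.one_div_lt {z : ℝ} (hz : Admissible z) : 1 / (z + 1) < z := by
  have := hz.pos
  rw [div_lt_iff₀ (by linarith)]
  nlinarith [hz.one_lt]

theorem Admissible.one_sub_lt {z : ℝ} (hz : Admissible z) : 1 - z < 1 / (z + 1) := by
  have := hz.pos
  rw [lt_div_iff₀ (by linarith)]
  nlinarith

theorem Admissible.inv_sub_one_lt {z : ℝ} (hz : Admissible z) : 1 / z - 1 < 1 / (z + 1) := by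
  have := hz.pos
  rw [div_sub_one this.ne', div_lt_div_iff₀ this (by linarith)]
  nlinarith [hz.one_lt]

theorem Admissible.inv_sub_one_pos {z : ℝ} (hz : Admissible z) : 0 < 1 / z - 1 := by
  have := hz.pos
  rw [div_sub_one this.ne']
  exact div_pos (by linarith [hz.lt_one]) this

theorem Admissible.orb_mem {z : ℝ} (hz : Admissible z) {δ : ℤ} (hδ : δ = 1 ∨ δ = -1) (n : ℕ) :
    z - 1 ≤ orb δ z n ∧ orb δ z n < z := by
  cases n with
  | zero =>
    rcases hδ with rfl | rfl
    · rw [orb_one_zero]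
      exact ⟨le_rfl, by linarith⟩
    · rw [orb_neg_one_zero]
      exact ⟨by linarith [hz.lt_one, hz.inv_sub_one_pos],
        hz.inv_sub_one_lt.trans hz.one_div_lt⟩
  | succ n =>
    rw [orb_succ]
    exact T_mem hz.pos hz.lt_one.le _

/-- Both critical orbits stay in `(-∞, 1/(z+1)]` before time `m`. -/
def Below (z : ℝ) (m : ℕ) : Prop :=
  ∀ n < m, orb 1 z n ≤ 1 / (z + 1) ∧ orb (-1) z n ≤ 1 / (z + 1)

theorem Below.le {z : ℝ} {m n : ℕ} (h : Below z m) (hn : n < m) {δ : ℤ} (hδ : δ = 1 ∨ δ = -1) :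
    orb δ z n ≤ 1 / (z + 1) := by
  rcases hδ with rfl | rfl
  · exact (h n hn).1
  · exact (h n hn).2

theorem Below.mono {z : ℝ} {m n : ℕ} (h : Below z m) (hn : n ≤ m) : Below z n :=
  fun k hk => h k (hk.trans_le hn)

theorem neg_eq_one_or {δ : ℤ} (hδ : δ = 1 ∨ δ = -1) : -δ = 1 ∨ -δ = -1 := by omega

theorem Below.linked {z : ℝ} {n : ℕ} (hz : Admissible z) (h : Below z n) {δ : ℤ}
    (hδ : δ = 1 ∨ δ = -1) : Linked z (orb δ z n) (orb (-δ) z n) := by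
  suffices H : Linked z (orb 1 z n) (orb (-1) z n) by
    rcases hδ with rfl | rfl
    · exact H
    · simpa using H.symm
  induction n with
  | zero =>
    rw [orb_one_zero, orb_neg_one_zero]
    refine Or.inl ⟨?_, by linarith [hz.one_sub_lt, hz.lt_one], hz.inv_sub_one_lt⟩
    have := hz.pos.ne'
    field_simp
    ring
  | succ n ih =>
    rw [orb_succ, orb_succ]
    exact (ih (h.mono n.le_succ)).map hz.half_lt hz.lt_one.le hz.one_lt
      (h n n.lt_succ_self).1 (h n n.lt_succ_self).2

theorem Linked.add_eq_one {z x y : ℝ} (hz : Admissible z) (h : Linked z x y) (hy : z - 1 ≤ y)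
    (hx : 1 / (z + 1) ≤ x) : x + y = 1 := by
  rcases h with ⟨-, h, -⟩ | h | h
  · linarith
  · linarith [hz.one_sub_lt]
  · exact h

/-- The parameter `z ∈ (g, 1)` is such that the orbit of `epow ε z` is the first one to exceed
`1/(z+1)`, at time `m`. -/
structure FirstExceeds (m : ℕ) (ε : ℤ) (z : ℝ) : Prop where
  g_lt : g < z
  lt_one : z < 1
  below : Below z m
  exceeds : 1 / (z + 1) < orb ε z m

theorem g_pos : 0 < g := by
  have : (1 : ℝ) < √5 := by
    rw [Real.lt_sqrt] <;> norm_num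
  unfold g
  linarith

theorem g_sq : g ^ 2 + g = 1 := by
  have h : (√5 : ℝ) ^ 2 = 5 := Real.sq_sqrt (by norm_num)
  unfold g
  nlinarith

theorem g_lt_one : g < 1 := by nlinarith [g_pos, g_sq]

theorem admissible_of_g_lt {z : ℝ} (h : g < z) (h1 : z < 1) : Admissible z := by
  have h0 := g_pos
  have h2 := g_sq
  exact ⟨by nlinarith, h1, by nlinarith⟩

theorem FirstExceeds.admissible {m : ℕ} {ε : ℤ} {z : ℝ} (h : FirstExceeds m ε z) : Admissible z :=
  admissible_of_g_lt h.g_lt h.lt_one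

theorem FirstExceeds.add_eq_one {m : ℕ} {ε : ℤ} {z : ℝ} (hε : ε = 1 ∨ ε = -1)
    (h : FirstExceeds m ε z) : orb ε z m + orb (-ε) z m = 1 :=
  (h.below.linked h.admissible hε).add_eq_one h.admissible
    (h.admissible.orb_mem (neg_eq_one_or hε) m).1 h.exceeds.le

theorem FirstExceeds.pos {m : ℕ} {ε : ℤ} {z : ℝ} (hε : ε = 1 ∨ ε = -1)
    (h : FirstExceeds m ε z) : 0 < m := by
  rcases Nat.eq_zero_or_pos m with rfl | hm
  · have h1 := h.exceeds
    have hz := h.admissible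
    rcases hε with rfl | rfl
    · rw [orb_one_zero] at h1
      linarith [hz.one_sub_lt, hz.lt_one]
    · rw [orb_neg_one_zero] at h1
      linarith [hz.inv_sub_one_lt]
  · exact hm

/-- The next iterate after exceeding `1/(z+1)` is positive, and the orbits match one step later. -/
theorem FirstExceeds.matching {m : ℕ} {ε : ℤ} {z : ℝ} (hε : ε = 1 ∨ ε = -1)
    (h : FirstExceeds m ε z) : orb ε z (m + 2) = orb (-ε) z (m + 1) ∧
      orb ε z (m + 1) ≠ orb (-ε) z m ∧ 0 < orb ε z (m + 1) := by
  have hz := h.admissible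
  have hx := h.exceeds
  have hsum := h.add_eq_one hε
  have hxz := (hz.orb_mem hε m).2
  have hT := T_eq_sub_one hz.pos hz.lt_one hx hxz
  rw [orb_succ, orb_succ, orb_succ, hT]
  obtain ⟨x, hxe⟩ : ∃ x, x = orb ε z m := ⟨_, rfl⟩
  have hye : orb (-ε) z m = 1 - x := by linarith
  rw [hye, ← hxe]
  rw [← hxe] at hx hxz
  have hx0 : 0 < x := lt_trans (by have := hz.pos; positivity) hx
  have hx1 : 0 < 1 - x := by linarith [hz.lt_one]
  have he : 1 / x - 1 = (1 - x) / x := by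
    field_simp
  have hp : 0 < 1 / x - 1 := by
    rw [he]
    positivity
  refine ⟨T_congr hp.ne' hx1.ne' (-1) ?_, ?_, hp⟩
  · rw [he]
    push_cast
    field_simp
    ring
  · rw [he]
    intro h'
    rw [div_eq_iff hx0.ne'] at h'
    nlinarith

theorem FirstExceeds.no_repeat {m : ℕ} {ε δ σ : ℤ} {z : ℝ} (hε : ε = 1 ∨ ε = -1)
    (h : FirstExceeds m ε z) (hδ : δ = 1 ∨ δ = -1) (hσ : σ = 1 ∨ σ = -1) {n j : ℕ} (hj : j < n)
    (hn : n ≤ m) (h1 : orb δ z n = orb σ z j) (h2 : orb (-δ) z n = orb (-σ) z j) : False := by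
  obtain ⟨k, rfl⟩ := Nat.exists_eq_add_of_le hn
  have hx := h.exceeds
  have hcases : ε = δ ∨ ε = -δ := by omega
  rcases hcases with rfl | rfl
  · rw [orb_add_eq h1] at hx
    exact absurd hx (h.below.le (by omega) hσ).not_gt
  · rw [orb_add_eq h2] at hx
    exact absurd hx (h.below.le (by omega) (neg_eq_one_or hσ)).not_gt

theorem T_sub_one_eq {z : ℝ} (hz : Admissible z) : T z (1 - z) = T z (1 / z - 1) := by
  have h1 : 1 - z ≠ 0 := by linarith [hz.lt_one]
  refine T_congr h1 hz.inv_sub_one_pos.ne' 1 ?_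
  have := hz.pos.ne'
  rw [div_sub_one this]
  push_cast
  field_simp
  ring

theorem FirstExceeds.orb_ne_sub_one {m : ℕ} {ε δ : ℤ} {z : ℝ} (hε : ε = 1 ∨ ε = -1)
    (h : FirstExceeds m ε z) (hδ : δ = 1 ∨ δ = -1) {n : ℕ} (hn0 : 0 < n) (hn : n ≤ m) :
    orb δ z n ≠ z - 1 := by
  intro hx
  have hz := h.admissible
  have hz0 := hz.pos
  rcases (h.below.mono hn).linked hz hδ with ⟨h1, -, -⟩ | h1 | h1
  · refine h.no_repeat hε hδ (Or.inl rfl) hn0 hn (hx.trans (orb_one_zero z).symm) ?_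
    rw [orb_neg_one_zero]
    rw [hx] at h1
    field_simp
    linarith
  · have hy : orb (-δ) z n = 1 - z := by linarith
    rcases hn.eq_or_lt with rfl | hn'
    · have hcases : ε = δ ∨ ε = -δ := by omega
      have h2 := h.exceeds
      rcases hcases with rfl | rfl <;> linarith [hz.one_sub_lt, hz.lt_one]
    · refine h.no_repeat hε hδ (Or.inl rfl) (j := 1) (n := n + 1) (by omega) hn' ?_ ?_
      · rw [orb_succ, orb_succ, hx, orb_one_zero]
      · rw [orb_succ, orb_succ, hy, orb_neg_one_zero, T_sub_one_eq hz]
  · linarith [(hz.orb_mem (neg_eq_one_or hδ) n).2, hz.lt_one]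

theorem T_one_div_add_one {z : ℝ} (hz : Admissible z) : T z (1 / (z + 1)) = z - 1 := by
  have hz0 := hz.pos
  have := (T_eq_sub_two (x := 1 / (z + 1)) hz0 hz.one_lt (by gcongr; exact hz.lt_one.le) le_rfl).1
  rw [this, one_div_one_div]
  ring

theorem T_div_add_one {z : ℝ} (hz : Admissible z) : T z (z / (z + 1)) = 1 / z - 1 := by
  have hz0 := hz.pos
  have := (T_eq_sub_two (x := z / (z + 1)) hz0 hz.one_lt le_rfl (by gcongr; exact hz.lt_one.le)).1
  rw [this, one_div_div, add_div, div_self hz0.ne']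
  ring

theorem FirstExceeds.orb_lt {m : ℕ} {ε δ : ℤ} {z : ℝ} (hε : ε = 1 ∨ ε = -1)
    (h : FirstExceeds m ε z) (hδ : δ = 1 ∨ δ = -1) {n : ℕ} (hn : n < m) :
    orb δ z n < 1 / (z + 1) := by
  refine (h.below.le hn hδ).lt_of_ne fun hx => ?_
  refine h.orb_ne_sub_one hε hδ (n := n + 1) (by omega) hn ?_
  rw [orb_succ, hx, T_one_div_add_one h.admissible]

theorem orb_eq_zero_of_le {δ : ℤ} {z : ℝ} {n m : ℕ} (h : orb δ z n = 0) (hn : n ≤ m) :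
    orb δ z m = 0 := by
  induction m, hn using Nat.le_induction with
  | base => exact h
  | succ k _ ih => rw [orb_succ, ih, T_zero]

theorem FirstExceeds.orb_ne_zero {m : ℕ} {ε δ : ℤ} {z : ℝ} (hε : ε = 1 ∨ ε = -1)
    (h : FirstExceeds m ε z) (hδ : δ = 1 ∨ δ = -1) {n : ℕ} (hn : n < m) :
    orb δ z n ≠ 0 := by
  intro hx
  have hz := h.admissible
  have hz0 := hz.pos
  have hy : orb (-δ) z n = 0 := by
    rcases (h.below.mono hn.le).linked hz hδ with ⟨h1, -, -⟩ | h1 | h1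
    · simpa [hx] using h1
    · simpa [hx] using h1
    · linarith [(hz.orb_mem (neg_eq_one_or hδ) n).2, hz.lt_one]
  have h2 : 0 < orb ε z m := lt_trans (by positivity) h.exceeds
  have hcases : ε = δ ∨ ε = -δ := by omega
  rcases hcases with rfl | rfl
  · exact h2.ne' (orb_eq_zero_of_le hx hn.le)
  · exact h2.ne' (orb_eq_zero_of_le hy hn.le)

/-! ### Transcendental parameters -/

theorem isAlgebraic_of_quadratic {w : ℝ} (a b c : ℤ) (h : a ≠ 0 ∨ c ≠ 0)
    (hw : a * w ^ 2 + b * w + c = 0) : IsAlgebraic ℚ w := by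
  refine ⟨Polynomial.C (a : ℚ) * Polynomial.X ^ 2 + Polynomial.C (b : ℚ) * Polynomial.X +
    Polynomial.C (c : ℚ), fun h0 => ?_, by simpa using hw⟩
  have h2 := congrArg (Polynomial.coeff · 2) h0
  have h1 := congrArg (Polynomial.coeff · 0) h0
  simp only [Polynomial.coeff_add, Polynomial.coeff_C_mul, Polynomial.coeff_X_pow,
    Polynomial.coeff_X, Polynomial.coeff_C, Polynomial.coeff_zero] at h2 h1
  norm_num at h2 h1
  rcases h with h | h
  · exact h h2
  · exact h h1

theorem Transcendental.ne_int {w : ℝ} (hw : Transcendental ℚ w) (k : ℤ) : w ≠ k := by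
  rintro rfl
  exact hw (isAlgebraic_intCast k)

theorem Transcendental.map_T {z w : ℝ} (hw : Transcendental ℚ w) : Transcendental ℚ (T z w) := by
  intro h
  have hw0 : w ≠ 0 := by simpa using hw.ne_int 0
  obtain ⟨k, hk⟩ := exists_T_eq (z := z) hw0
  have h2 := (h.add (isAlgebraic_intCast k)).inv
  rw [hk] at h2
  exact hw (by simpa using h2)

theorem Transcendental.orb {δ : ℤ} {z : ℝ} (hz : Transcendental ℚ z) (n : ℕ) :
    Transcendental ℚ (orb δ z n) := by
  induction n with
  | zero =>
    intro h
    simp only [_root_.orb, Function.iterate_zero, id, epow] at h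
    have h2 := h.add (isAlgebraic_intCast 1)
    split_ifs at h2
    · exact hz (by simpa using h2)
    · exact hz (by simpa using h2.inv)
  | succ n ih =>
    rw [orb_succ]
    exact ih.map_T

theorem exists_T_T_eq {z x : ℝ} {k : ℤ} (hx : x ≠ 0) (hk : T z x = 1 / x - k)
    (h0 : T z x ≠ 0) : ∃ l : ℤ, T z (T z x) = x / (1 - x * k) - l ∧ 1 - x * k ≠ 0 := by
  obtain ⟨l, hl⟩ := exists_T_eq (z := z) h0
  have he : T z x = (1 - x * k) / x := by
    rw [hk]
    field_simp
  refine ⟨l, by rw [hl, he, one_div_div], fun h => h0 ?_⟩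
  rw [he, h, zero_div]

theorem T_T_ne_T {z x y : ℝ} (hz : Admissible z) (hl : Linked z x y) (hx : x ≤ 1 / (z + 1))
    (hy : y ≤ 1 / (z + 1)) (htx : Transcendental ℚ x) (hty : Transcendental ℚ y) :
    T z (T z x) ≠ T z y := by
  intro h
  have hx0 : x ≠ 0 := by simpa using htx.ne_int 0
  have hy0 : y ≠ 0 := by simpa using hty.ne_int 0
  have hT0 : T z x ≠ 0 := by simpa using (htx.map_T (z := z)).ne_int 0
  obtain ⟨k, hk⟩ := exists_T_eq (z := z) hx0
  obtain ⟨l, hTT, hkx⟩ := exists_T_T_eq hx0 hk hT0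
  have key : ∀ j : ℤ, T z y ≠ -(1 / x) - j := by
    intro j hj
    rw [hTT, hj] at h
    refine htx (isAlgebraic_of_quadratic (1 + k * (l - j)) (-k - (l - j)) 1 (by simp) ?_)
    field_simp at h
    push_cast
    linear_combination h
  rcases hl with ⟨hl, -, -⟩ | hl | hl
  · obtain ⟨j, hj⟩ := exists_T_eq (z := z) hy0
    refine key (1 + j) ?_
    rw [hj]
    push_cast
    field_simp
    linear_combination hl
  · obtain ⟨j, hj⟩ := exists_T_eq (z := z) hy0
    refine key j ?_
    rw [hj]
    obtain rfl : y = -x := by linarith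
    ring
  · have he : 1 - 1 / (z + 1) = z / (z + 1) := by
      have := hz.pos
      field_simp
      ring
    have hTx := (T_eq_sub_two (x := x) hz.pos hz.one_lt (by linarith) hx).1
    have hTy := (T_eq_sub_two (x := y) hz.pos hz.one_lt (by linarith) hy).1
    obtain rfl : k = 2 := by
      have : (k : ℝ) = 2 := by linarith
      exact_mod_cast this
    rw [hTT, hTy] at h
    obtain rfl : y = 1 - x := by linarith
    refine htx (isAlgebraic_of_quadratic (1 + 2 * (l - 2)) (-3 - 3 * (l - 2)) (1 + (l - 2))
      (by omega) ?_)
    push_cast at hkx h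
    field_simp at h
    push_cast
    linear_combination -h

theorem T_T_ne_self {z x : ℝ} (hz : Admissible z) (hl : z - 1 ≤ x) (hu : x < z)
    (htx : Transcendental ℚ x) : T z (T z x) ≠ x := by
  intro h
  have hx0 : x ≠ 0 := by simpa using htx.ne_int 0
  have hT0 : T z x ≠ 0 := by simpa using (htx.map_T (z := z)).ne_int 0
  obtain ⟨k, hk⟩ := exists_T_eq (z := z) hx0
  have hT := T_mem hz.pos hz.lt_one.le x
  have h1 := hz.half_lt
  have h2 := hz.lt_one
  have hk0 : k ≠ 0 := by
    rintro rfl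
    have h3 : T z x * x = 1 := by
      rw [hk]
      push_cast
      field_simp
      ring
    have h4 : |T z x| < 1 := abs_lt.2 ⟨by linarith, by linarith⟩
    have h5 : |x| < 1 := abs_lt.2 ⟨by linarith, by linarith⟩
    have h6 : |T z x| * |x| < 1 := mul_lt_one_of_nonneg_of_lt_one_left (abs_nonneg _) h4 h5.le
    rw [← abs_mul, h3, abs_one] at h6
    exact lt_irrefl _ h6
  obtain ⟨l, hTT, hkx⟩ := exists_T_T_eq hx0 hk hT0
  rw [hTT] at h
  refine htx (isAlgebraic_of_quadratic k (k * l) (-l) (Or.inl hk0) ?_)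
  field_simp at h
  push_cast
  linear_combination h

theorem exists_firstExceeds {z : ℝ} (hg : g < z) (h1 : z < 1) {m : ℕ} (h : ¬Below z (m + 1)) :
    ∃ n ≤ m, ∃ δ : ℤ, (δ = 1 ∨ δ = -1) ∧ FirstExceeds n δ z := by
  classical
  have hex : ∃ n, ¬(orb 1 z n ≤ 1 / (z + 1) ∧ orb (-1) z n ≤ 1 / (z + 1)) ∧ n ≤ m := by
    by_contra hc
    refine h fun n hn => ?_
    by_contra hn'
    exact hc ⟨n, hn', by omega⟩
  obtain ⟨hn, hnm⟩ := Nat.find_spec hex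
  have hb : Below z (Nat.find hex) := by
    intro k hk
    by_contra hk'
    exact Nat.find_min hex hk ⟨hk', by omega⟩
  refine ⟨_, hnm, ?_⟩
  by_cases ho : orb 1 z (Nat.find hex) ≤ 1 / (z + 1)
  · exact ⟨-1, Or.inr rfl, hg, h1, hb, not_le.1 fun h' => hn ⟨ho, h'⟩⟩
  · exact ⟨1, Or.inl rfl, hg, h1, hb, not_le.1 ho⟩

/-- For transcendental parameters, matching can only be caused by an orbit exceeding `1/(z+1)`. -/
theorem firstExceeds_of_matching {z : ℝ} (hg : g < z) (h1 : z < 1) (ht : Transcendental ℚ z)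
    {m : ℕ} {ε : ℤ} (hε : ε = 1 ∨ ε = -1) (h : orb ε z (m + 2) = orb (-ε) z (m + 1))
    (hne : orb ε z (m + 1) ≠ orb (-ε) z m) : FirstExceeds m ε z := by
  have hz := admissible_of_g_lt hg h1
  by_cases hb : Below z (m + 1)
  · rw [orb_succ, orb_succ, orb_succ] at h
    exact absurd h (T_T_ne_T hz ((hb.mono m.le_succ).linked hz hε) (hb.le m.lt_succ_self hε)
      (hb.le m.lt_succ_self (neg_eq_one_or hε)) (ht.orb m) (ht.orb m))
  · obtain ⟨n, hn, δ, hδ, hE⟩ := exists_firstExceeds hg h1 hb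
    have hmatch := (hE.matching hδ).1
    have hcases : δ = ε ∨ δ = -ε := by omega
    rcases hcases with rfl | rfl
    · rcases hn.eq_or_lt with rfl | hn
      · exact hE
      · obtain ⟨k, rfl⟩ := Nat.exists_eq_add_of_lt hn
        refine absurd ?_ hne
        have := orb_add_eq hmatch k
        rwa [show n + 2 + k = n + k + 1 + 1 by ring, show n + 1 + k = n + k + 1 by ring] at this
    · obtain ⟨k, rfl⟩ := Nat.exists_eq_add_of_le hn
      have h2 := orb_add_eq hmatch k
      rw [neg_neg, show n + 2 + k = n + k + 1 + 1 by ring,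
        show n + 1 + k = n + k + 1 by ring, orb_succ, ← h, show n + k + 2 = n + k + 1 + 1 by ring,
        orb_succ] at h2
      have hm := hz.orb_mem hε (n + k + 1)
      exact absurd h2 (T_T_ne_self hz hm.1 hm.2 (ht.orb _))

/-! ### Continuity of the critical orbits in the parameter -/

theorem eventually_floor_eq {x : ℝ} (hx : x ≠ ⌊x⌋) : ∀ᶠ y in nhds x, ⌊y⌋ = ⌊x⌋ := by
  filter_upwards [Ioo_mem_nhds ((Int.floor_le x).lt_of_ne' hx) (Int.lt_floor_add_one x)]
    with y hy
  exact Int.floor_eq_iff.2 ⟨hy.1.le, hy.2⟩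

theorem eventually_digit_eq {f : ℝ → ℝ} {z : ℝ} (hf : ContinuousAt f z) (h0 : f z ≠ 0)
    (hT : T z (f z) ≠ z - 1) :
    ∀ᶠ w in nhds z, ⌊1 / f w + 1 - w⌋ = ⌊1 / f z + 1 - z⌋ := by
  have hc : ContinuousAt (fun w => 1 / f w + 1 - w) z := by fun_prop (disch := assumption)
  refine hc.eventually (eventually_floor_eq fun h => hT ?_)
  rw [T, if_neg h0, ← h]
  ring

theorem continuousAt_T {f : ℝ → ℝ} {z : ℝ} (hf : ContinuousAt f z) (h0 : f z ≠ 0)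
    (hT : T z (f z) ≠ z - 1) : ContinuousAt (fun w => T w (f w)) z := by
  have hc : ContinuousAt (fun w => 1 / f w - (⌊1 / f z + 1 - z⌋ : ℝ)) z := by
    fun_prop (disch := assumption)
  refine hc.congr ?_
  filter_upwards [eventually_digit_eq hf h0 hT, hf.eventually_ne h0] with w hw hw0
  rw [T, if_neg hw0, hw]

theorem continuousAt_epow {z : ℝ} (hz : 0 < z) (δ : ℤ) : ContinuousAt (epow δ) z := by
  have := hz.ne'
  unfold epow
  split_ifs <;> fun_prop (disch := assumption)

theorem FirstExceeds.continuousAt_orb {m : ℕ} {ε δ : ℤ} {z : ℝ} (hε : ε = 1 ∨ ε = -1)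
    (h : FirstExceeds m ε z) (hδ : δ = 1 ∨ δ = -1) {n : ℕ} (hn : n ≤ m) :
    ContinuousAt (fun w => orb δ w n) z := by
  induction n with
  | zero => exact continuousAt_epow h.admissible.pos δ
  | succ n ih =>
    simp only [orb_succ]
    refine continuousAt_T (ih (by omega)) (h.orb_ne_zero hε hδ hn) ?_
    rw [← orb_succ]
    exact h.orb_ne_sub_one hε hδ n.succ_pos hn

theorem isOpen_firstExceeds {m : ℕ} {ε : ℤ} (hε : ε = 1 ∨ ε = -1) :
    IsOpen {z | FirstExceeds m ε z} := by
  rw [isOpen_iff_eventually]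
  intro z hz
  have hz0 : z + 1 ≠ 0 := by linarith [hz.admissible.pos]
  have hd : ContinuousAt (fun w : ℝ => 1 / (w + 1)) z := by fun_prop (disch := assumption)
  have hbelow : ∀ᶠ w in nhds z, Below w m := by
    refine (Filter.eventually_all_finite (Set.finite_lt_nat m)).2 fun n hn => ?_
    filter_upwards [(hz.continuousAt_orb hε (Or.inl rfl) (le_of_lt hn)).eventually_lt hd
      (hz.orb_lt hε (Or.inl rfl) hn), (hz.continuousAt_orb hε (Or.inr rfl)
      (le_of_lt hn)).eventually_lt hd (hz.orb_lt hε (Or.inr rfl) hn)] with w h1 h2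
    exact ⟨h1.le, h2.le⟩
  filter_upwards [Ioo_mem_nhds hz.g_lt hz.lt_one, hbelow,
    hd.eventually_lt (hz.continuousAt_orb hε hε le_rfl) hz.exceeds] with w h1 h2 h3
  exact ⟨h1.1, h1.2, h2, h3⟩

theorem IsOpen.exists_component {S : Set ℝ} (hS : IsOpen S) {c d x : ℝ} (hx : x ∈ S)
    (hc : c ∉ S) (hd : d ∉ S) (hcx : c < x) (hxd : x < d) :
    ∃ a b, c ≤ a ∧ a < x ∧ x < b ∧ b ≤ d ∧ Ioo a b ⊆ S ∧ a ∉ S ∧ b ∉ S := by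
  have hl : IsClosed (Sᶜ ∩ Iic x) := hS.isClosed_compl.inter isClosed_Iic
  have hr : IsClosed (Sᶜ ∩ Ici x) := hS.isClosed_compl.inter isClosed_Ici
  have hlb : BddAbove (Sᶜ ∩ Iic x) := ⟨x, fun y hy => hy.2⟩
  have hrb : BddBelow (Sᶜ ∩ Ici x) := ⟨x, fun y hy => hy.2⟩
  have ha := hl.csSup_mem ⟨c, hc, hcx.le⟩ hlb
  have hb := hr.csInf_mem ⟨d, hd, hxd.le⟩ hrb
  have hax : sSup (Sᶜ ∩ Iic x) ≠ x := fun h => ha.1 (by rwa [h])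
  have hbx : x ≠ sInf (Sᶜ ∩ Ici x) := fun h => hb.1 (by rwa [← h])
  refine ⟨sSup (Sᶜ ∩ Iic x), sInf (Sᶜ ∩ Ici x), le_csSup hlb ⟨hc, hcx.le⟩,
    lt_of_le_of_ne ha.2 hax, lt_of_le_of_ne hb.2 hbx, csInf_le hrb ⟨hd, hxd.le⟩, ?_, ha.1, hb.1⟩
  intro y hy
  by_contra hyS
  rcases le_total y x with hyx | hyx
  · exact (le_csSup hlb ⟨hyS, hyx⟩).not_gt hy.1
  · exact (csInf_le hrb ⟨hyS, hyx⟩).not_gt hy.2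

/-! ### Branches over an interval of parameters -/

section Branch

variable {m : ℕ} {ε δ : ℤ} {a b : ℝ}

theorem exists_digit (hε : ε = 1 ∨ ε = -1) (hδ : δ = 1 ∨ δ = -1)
    (hJ : ∀ z ∈ Ioo a b, FirstExceeds m ε z) {n : ℕ} (hn : n < m) :
    ∃ k : ℤ, ∀ z ∈ Ioo a b, orb δ z (n + 1) = 1 / orb δ z n - k := by
  have hc : ContinuousOn (fun z => ⌊1 / orb δ z n + 1 - z⌋) (Ioo a b) := by
    intro z hz
    have h := hJ z hz
    have hT : T z (orb δ z n) ≠ z - 1 := by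
      rw [← orb_succ]
      exact h.orb_ne_sub_one hε hδ n.succ_pos hn
    have h2 := eventually_digit_eq (h.continuousAt_orb hε hδ hn.le) (h.orb_ne_zero hε hδ hn) hT
    exact ((continuousAt_const (y := ⌊1 / orb δ z n + 1 - z⌋)).congr
      (h2.mono fun w hw => hw.symm)).continuousWithinAt
  rcases (Ioo a b).eq_empty_or_nonempty with he | ⟨c, hcJ⟩
  · exact ⟨0, fun z hz => absurd hz (he ▸ notMem_empty z)⟩
  · refine ⟨⌊1 / orb δ c n + 1 - c⌋, fun z hz => ?_⟩
    rw [orb_succ, T, if_neg ((hJ z hz).orb_ne_zero hε hδ hn),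
      isPreconnected_Ioo.constant hc hz hcJ]

theorem FirstExceeds.abs_orb_lt_one {z : ℝ} (h : FirstExceeds m ε z) (hδ : δ = 1 ∨ δ = -1)
    (n : ℕ) : |orb δ z n| < 1 := by
  have h1 := h.admissible.orb_mem hδ n
  have h2 := h.admissible.pos
  have h3 := h.lt_one
  exact abs_lt.2 ⟨by linarith, by linarith⟩

/-- The branches `z ↦ orb δ z n` are expanding, with alternating orientation. -/
theorem le_orb_sub_orb (hε : ε = 1 ∨ ε = -1) (hδ : δ = 1 ∨ δ = -1)
    (hJ : ∀ z ∈ Ioo a b, FirstExceeds m ε z) {z w : ℝ} (hz : z ∈ Ioo a b) (hw : w ∈ Ioo a b)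
    (hzw : z < w) {n : ℕ} (hn : n ≤ m) :
    w - z ≤ (-1) ^ n * δ * (orb δ w n - orb δ z n) := by
  have hz' := hJ z hz
  have hw' := hJ w hw
  induction n with
  | zero =>
    rcases hδ with rfl | rfl
    · simp [orb_one_zero]
    · rw [orb_neg_one_zero, orb_neg_one_zero]
      have h1 := hz'.admissible.pos
      have h2 := hw'.admissible.pos
      have h3 : z * w ≤ 1 := by nlinarith [hz'.lt_one, hw'.lt_one]
      have h4 : (-1) ^ 0 * ((-1 : ℤ) : ℝ) * (1 / w - 1 - (1 / z - 1)) = (w - z) / (z * w) := by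
        push_cast
        field_simp
        ring
      rw [h4, le_div_iff₀ (by positivity)]
      nlinarith
  | succ n ih =>
    have ih := ih (by omega)
    obtain ⟨k, hk⟩ := exists_digit hε hδ hJ (n := n) hn
    have hx0 := hz'.orb_ne_zero hε hδ hn
    have hy0 := hw'.orb_ne_zero hε hδ hn
    have hx1 := hz'.abs_orb_lt_one hδ n
    have hy1 := hw'.abs_orb_lt_one hδ n
    have hTx := hz'.abs_orb_lt_one hδ (n + 1)
    have hTy := hw'.abs_orb_lt_one hδ (n + 1)
    rw [hk z hz] at hTx
    rw [hk w hw] at hTy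
    rw [hk z hz, hk w hw]
    generalize orb δ z n = x at *
    generalize orb δ w n = y at *
    have hprod : 0 < x * y := by
      rw [abs_lt] at hTx hTy hx1 hy1
      rcases lt_trichotomy k 0 with h | rfl | h
      · have h' : (k : ℝ) ≤ -1 := by exact_mod_cast (by omega : k ≤ -1)
        have h1 : x < 0 := one_div_neg.1 (by linarith)
        have h2 : y < 0 := one_div_neg.1 (by linarith)
        exact mul_pos_of_neg_of_neg h1 h2
      · exfalso
        push_cast at hTx
        rcases lt_or_gt_of_ne hx0 with h | h
        · have : 1 / x < -1 := by
            rw [div_lt_iff_of_neg h]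
            linarith
          linarith
        · have : 1 < 1 / x := by
            rw [lt_div_iff₀ h]
            linarith
          linarith
      · have h' : (1 : ℝ) ≤ k := by exact_mod_cast h
        have h1 : 0 < x := one_div_pos.1 (by linarith)
        have h2 : 0 < y := one_div_pos.1 (by linarith)
        exact mul_pos h1 h2
    have hle : x * y ≤ 1 := by
      have h1 : |x| * |y| < 1 := mul_lt_one_of_nonneg_of_lt_one_left (abs_nonneg _) hx1 hy1.le
      rw [← abs_mul] at h1
      exact (le_abs_self _).trans h1.le
    have he : (-1) ^ (n + 1) * δ * (1 / y - k - (1 / x - k)) =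
        ((-1) ^ n * δ * (y - x)) / (x * y) := by
      field_simp
      ring
    rw [he, le_div_iff₀ hprod]
    nlinarith

theorem exists_tendsto_orb (hε : ε = 1 ∨ ε = -1) (hδ : δ = 1 ∨ δ = -1) (hab : a < b)
    (hJ : ∀ z ∈ Ioo a b, FirstExceeds m ε z) {e : ℝ} (he : e ∈ Icc a b) (he0 : 0 < e) :
    ∃ L : ℕ → ℝ, L 0 = epow δ e ∧
      (∀ n ≤ m, Tendsto (fun z => orb δ z n) (nhdsWithin e (Ioo a b)) (nhds (L n))) ∧
      ∀ n < m, L n ≠ 0 ∧ ∃ k : ℤ, L (n + 1) = 1 / L n - k := by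
  have hne : (nhdsWithin e (Ioo a b)).NeBot :=
    mem_closure_iff_nhdsWithin_neBot.1 (by rwa [closure_Ioo hab.ne])
  have hk : ∀ n, ∃ k : ℤ, n < m → ∀ z ∈ Ioo a b, orb δ z (n + 1) = 1 / orb δ z n - k := by
    intro n
    by_cases hn : n < m
    · obtain ⟨k, hk⟩ := exists_digit hε hδ hJ hn
      exact ⟨k, fun _ => hk⟩
    · exact ⟨0, fun h => absurd h hn⟩
  choose k hk using hk
  let L : ℕ → ℝ := fun n => Nat.rec (epow δ e) (fun i x => 1 / x - k i) n
  have hL : ∀ n, L (n + 1) = 1 / L n - k n := fun n => rfl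
  have hne0 : ∀ n < m, Tendsto (fun z => orb δ z n) (nhdsWithin e (Ioo a b)) (nhds (L n)) →
      L n ≠ 0 := by
    intro n hn ht
    have hpos : (0 : ℝ) < 1 / (|(k n : ℝ)| + 1) := by positivity
    have hge : 1 / (|(k n : ℝ)| + 1) ≤ |L n| := by
      refine ge_of_tendsto ht.abs ?_
      filter_upwards [self_mem_nhdsWithin] with z hz
      have h1 := (hJ z hz).abs_orb_lt_one hδ (n + 1)
      have h0 := (hJ z hz).orb_ne_zero hε hδ hn
      have h2 : 1 / orb δ z n = orb δ z (n + 1) + k n := by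
        rw [hk n hn z hz]
        ring
      rw [div_le_comm₀ (by positivity) (abs_pos.2 h0), ← abs_one_div, h2]
      linarith [abs_add_le (orb δ z (n + 1)) (k n)]
    exact abs_pos.1 (hpos.trans_le hge)
  have ht : ∀ n ≤ m, Tendsto (fun z => orb δ z n) (nhdsWithin e (Ioo a b)) (nhds (L n)) := by
    intro n hn
    induction n with
    | zero => exact (continuousAt_epow he0 δ).tendsto.mono_left nhdsWithin_le_nhds
    | succ n ih =>
      have ih := ih (by omega)
      refine Tendsto.congr' ?_ ((tendsto_const_nhds.div ih (hne0 n hn ih)).sub_const (k n : ℝ))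
      filter_upwards [self_mem_nhdsWithin] with z hz
      exact (hk n hn z hz).symm
  exact ⟨L, rfl, ht, fun n hn => ⟨hne0 n hn (ht n hn.le), k n, hL n⟩⟩

theorem orb_eq_of_lt {e : ℝ} {L : ℕ → ℝ} (h0 : L 0 = epow δ e)
    (hL : ∀ n < m, L n ≠ 0 ∧ ∃ k : ℤ, L (n + 1) = 1 / L n - k)
    (hl : ∀ n ≤ m, e - 1 ≤ L n) {N : ℕ} (hN : N ≤ m) (hu : ∀ n ≤ N, L n < e) :
    ∀ n ≤ N, orb δ e n = L n := by
  intro n hn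
  induction n with
  | zero => exact h0.symm
  | succ n ih =>
    obtain ⟨hne, k, hk⟩ := hL n (by omega)
    rw [orb_succ, ih (by omega), hk]
    have h1 := hl (n + 1) (by omega)
    have h2 := hu (n + 1) hn
    rw [hk] at h1 h2
    exact T_eq hne h1 h2

/-- At an endpoint of a component, the orbit branch tends either to the endpoint itself or to the
threshold; in the latter case it is attained by the true orbit. -/
theorem endpoint_cases (hε : ε = 1 ∨ ε = -1) (hab : a < b)
    (hJ : ∀ z ∈ Ioo a b, FirstExceeds m ε z) {e : ℝ} (he : e ∈ Icc a b) (hge : g < e)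
    (he1 : e < 1) (hne : ¬FirstExceeds m ε e) :
    ∃ F, Tendsto (fun z => orb ε z m) (nhdsWithin e (Ioo a b)) (nhds F) ∧
      (F = e ∨ (F = 1 / (e + 1) ∧ orb ε e m = 1 / (e + 1) ∧ Below e m)) := by
  have hadm := admissible_of_g_lt hge he1
  have hbot : (nhdsWithin e (Ioo a b)).NeBot :=
    mem_closure_iff_nhdsWithin_neBot.1 (by rwa [closure_Ioo hab.ne])
  have hd0 : e + 1 ≠ 0 := by linarith [hadm.pos]
  have hd : Tendsto (fun w : ℝ => 1 / (w + 1)) (nhdsWithin e (Ioo a b)) (nhds (1 / (e + 1))) := by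
    have : ContinuousAt (fun w : ℝ => 1 / (w + 1)) e := by fun_prop (disch := assumption)
    exact this.tendsto.mono_left nhdsWithin_le_nhds
  have hid : Tendsto (fun w : ℝ => w) (nhdsWithin e (Ioo a b)) (nhds e) :=
    tendsto_id.mono_left nhdsWithin_le_nhds
  have hlim : ∀ δ : ℤ, δ = 1 ∨ δ = -1 → ∃ L : ℕ → ℝ,
      Tendsto (fun z => orb δ z m) (nhdsWithin e (Ioo a b)) (nhds (L m)) ∧
      (∀ n < m, orb δ e n = L n ∧ L n ≤ 1 / (e + 1)) ∧ (L m < e → orb δ e m = L m) ∧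
      L m ≤ e := by
    intro δ hδ
    obtain ⟨L, h0, ht, hL⟩ := exists_tendsto_orb hε hδ hab hJ he hadm.pos
    have hl : ∀ n ≤ m, e - 1 ≤ L n := fun n hn =>
      le_of_tendsto_of_tendsto (hid.sub_const 1) (ht n hn) (by
        filter_upwards [self_mem_nhdsWithin] with z hz
        exact ((hJ z hz).admissible.orb_mem hδ n).1)
    have hu : ∀ n < m, L n ≤ 1 / (e + 1) := fun n hn =>
      le_of_tendsto_of_tendsto (ht n hn.le) hd (by
        filter_upwards [self_mem_nhdsWithin] with z hz
        exact (hJ z hz).below.le hn hδ)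
    have hu' : ∀ n < m, L n < e := fun n hn => (hu n hn).trans_lt hadm.one_div_lt
    refine ⟨L, ht m le_rfl, fun n hn => ⟨?_, hu n hn⟩, fun hm => ?_, ?_⟩
    · exact orb_eq_of_lt h0 hL hl hn.le (fun j hj => hu' j (hj.trans_lt hn)) n le_rfl
    · refine orb_eq_of_lt h0 hL hl le_rfl (fun j hj => ?_) m le_rfl
      rcases hj.eq_or_lt with rfl | hj
      · exact hm
      · exact hu' j hj
    · refine le_of_tendsto_of_tendsto (ht m le_rfl) hid ?_
      filter_upwards [self_mem_nhdsWithin] with z hz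
      exact ((hJ z hz).admissible.orb_mem hδ m).2.le
  obtain ⟨L, hL, hLn, hLm, hLe⟩ := hlim 1 (Or.inl rfl)
  obtain ⟨K, hK, hKn, -, -⟩ := hlim (-1) (Or.inr rfl)
  have hbelow : Below e m := fun n hn =>
    ⟨(hLn n hn).1.trans_le (hLn n hn).2, (hKn n hn).1.trans_le (hKn n hn).2⟩
  obtain ⟨F, hF, -, hFm, hFe⟩ := hlim ε hε
  refine ⟨F m, hF, ?_⟩
  rcases hFe.eq_or_lt with h | h
  · exact Or.inl h
  · have hge' : 1 / (e + 1) ≤ F m := by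
      refine le_of_tendsto_of_tendsto hd hF ?_
      filter_upwards [self_mem_nhdsWithin] with z hz
      exact (hJ z hz).exceeds.le
    have horb := hFm h
    rcases hge'.eq_or_lt with h' | h'
    · exact Or.inr ⟨h'.symm, horb.trans h'.symm, hbelow⟩
    · exact absurd ⟨hge, he1, hbelow, horb ▸ h'⟩ hne

end Branch

/-! ### Parameters close to `g` -/

/-- The absolute value of the critical orbits for parameters close to `g`. -/
noncomputable def modulusSeq (z : ℝ) : ℕ → ℝ
  | 0 => 1 - z
  | n + 1 => 3 - 1 / modulusSeq z n

theorem modulusSeq_le {z : ℝ} (hz : Admissible z) {m : ℕ} (hpos : ∀ n ≤ m, 0 < modulusSeq z n) :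
    ∀ n ≤ m, modulusSeq z n ≤ 1 - z := by
  intro n hn
  induction n with
  | zero => exact le_rfl
  | succ n ih =>
    have ih := ih (by omega)
    refine le_trans ?_ ih
    have h0 := hpos n (by omega)
    have h1 := hz.one_lt
    have h2 := hz.half_lt
    rw [modulusSeq, sub_le_iff_le_add, ← sub_le_iff_le_add', le_div_iff₀ h0]
    nlinarith

theorem orb_eq_modulusSeq {z : ℝ} (hz : Admissible z) {m : ℕ}
    (hpos : ∀ n ≤ m, 0 < modulusSeq z n) (n : ℕ) (hn : n + 1 ≤ m) :
    (orb 1 z (n + 1) = modulusSeq z (n + 1) ∧ orb (-1) z (n + 1) = -modulusSeq z (n + 1)) ∨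
    (orb 1 z (n + 1) = -modulusSeq z (n + 1) ∧ orb (-1) z (n + 1) = modulusSeq z (n + 1)) := by
  have hh := hz.half_lt
  have hstep : ∀ k, k + 1 ≤ m → T z (-modulusSeq z k) = modulusSeq z (k + 1) ∧
      T z (modulusSeq z k) = -modulusSeq z (k + 1) := by
    intro k hk
    have h0 := hpos k (by omega)
    have h1 := hpos (k + 1) hk
    have h2 := modulusSeq_le hz hpos (k + 1) hk
    have e1 : modulusSeq z (k + 1) = 1 / (-modulusSeq z k) - ((-3 : ℤ) : ℝ) := by
      rw [modulusSeq, div_neg]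
      push_cast
      ring
    have e2 : -modulusSeq z (k + 1) = 1 / modulusSeq z k - ((3 : ℤ) : ℝ) := by
      rw [modulusSeq]
      push_cast
      ring
    constructor
    · rw [e1]
      exact T_eq (neg_ne_zero.2 h0.ne') (by rw [← e1]; linarith [hz.lt_one])
        (by rw [← e1]; linarith)
    · rw [e2]
      exact T_eq h0.ne' (by rw [← e2]; linarith) (by rw [← e2]; linarith)
  induction n with
  | zero =>
    have h := hstep 0 hn
    refine Or.inl ⟨?_, ?_⟩
    · rw [orb_succ, orb_one_zero, ← h.1, modulusSeq, neg_sub]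
    · rw [orb_succ, orb_neg_one_zero, ← h.2, modulusSeq, T_sub_one_eq hz]
  | succ n ih =>
    have h := hstep (n + 1) hn
    rw [orb_succ, orb_succ _ _ (n + 1)]
    rcases ih (by omega) with ⟨h1, h2⟩ | ⟨h1, h2⟩
    · rw [h1, h2]
      exact Or.inr ⟨h.2, h.1⟩
    · rw [h1, h2]
      exact Or.inl ⟨h.1, h.2⟩

theorem eventually_not_firstExceeds (m : ℕ) {ε : ℤ} (hε : ε = 1 ∨ ε = -1) :
    ∀ᶠ z in nhds g, ¬FirstExceeds m ε z := by
  have h1g : 1 - g ≠ 0 := by linarith [g_lt_one]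
  have hg : ∀ n, modulusSeq g n = 1 - g := by
    intro n
    induction n with
    | zero => rfl
    | succ n ih =>
      rw [modulusSeq, ih]
      field_simp
      linear_combination -g_sq
  have hc : ∀ n, ContinuousAt (fun z => modulusSeq z n) g := by
    intro n
    induction n with
    | zero => exact continuousAt_const.sub continuousAt_id
    | succ n ih => exact continuousAt_const.sub (continuousAt_const.div ih (by rwa [hg n]))
  have hev : ∀ᶠ z in nhds g, ∀ n ≤ m, 0 < modulusSeq z n :=
    (Filter.eventually_all_finite (Set.finite_le_nat m)).2 fun n _ =>
      continuousAt_const.eventually_lt (hc n) (by rw [hg n]; linarith [g_lt_one])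
  filter_upwards [hev] with z hpos h
  have hz := h.admissible
  obtain ⟨n, rfl⟩ := Nat.exists_eq_add_of_le' (h.pos hε)
  have h1 := h.exceeds
  have h2 := modulusSeq_le hz hpos (n + 1) le_rfl
  have h3 := hpos (n + 1) le_rfl
  have h4 := hz.one_sub_lt
  rcases orb_eq_modulusSeq hz hpos n le_rfl with ⟨h5, h6⟩ | ⟨h5, h6⟩ <;>
    rcases hε with rfl | rfl <;> linarith

/-! ### Components of the set of exceeding parameters -/

/-- The orbit of `epow ε e` hits the threshold `1/(e+1)` exactly at time `m`. -/
structure HitsThreshold (m : ℕ) (ε : ℤ) (e : ℝ) : Prop where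
  below : Below e m
  eq : orb ε e m = 1 / (e + 1)

theorem FirstExceeds.exists_component {m : ℕ} {ε : ℤ} {z : ℝ} (hε : ε = 1 ∨ ε = -1)
    (h : FirstExceeds m ε z) :
    ∃ a b, g < a ∧ a < z ∧ z < b ∧ b < 1 ∧ (∀ w ∈ Ioo a b, FirstExceeds m ε w) ∧
      ¬FirstExceeds m ε a ∧ ¬FirstExceeds m ε b ∧
      (((-1) ^ m * ε = 1 ∧ HitsThreshold m ε a ∧
          Tendsto (fun w => orb ε w m) (nhdsWithin b (Ioo a b)) (nhds b)) ∨
        ((-1) ^ m * ε = -1 ∧ HitsThreshold m ε b ∧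
          Tendsto (fun w => orb ε w m) (nhdsWithin a (Ioo a b)) (nhds a))) := by
  have hm := h.pos hε
  obtain ⟨a, b, hga, haz, hzb, hb1, hJ, ha, hb⟩ := (isOpen_firstExceeds hε).exists_component h
    (c := g) (d := 1) (fun h' => lt_irrefl _ h'.g_lt) (fun h' => lt_irrefl _ h'.lt_one)
    h.g_lt h.lt_one
  have hab := haz.trans hzb
  have hJ : ∀ w ∈ Ioo a b, FirstExceeds m ε w := hJ
  have ha : ¬FirstExceeds m ε a := ha
  have hb : ¬FirstExceeds m ε b := hb
  have hbota : (nhdsWithin a (Ioo a b)).NeBot :=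
    mem_closure_iff_nhdsWithin_neBot.1 (by rw [closure_Ioo hab.ne]; exact left_mem_Icc.2 hab.le)
  have hbotb : (nhdsWithin b (Ioo a b)).NeBot :=
    mem_closure_iff_nhdsWithin_neBot.1 (by rw [closure_Ioo hab.ne]; exact right_mem_Icc.2 hab.le)
  have hga : g < a := by
    refine hga.lt_of_ne ?_
    rintro rfl
    have hev := (eventually_not_firstExceeds m hε).filter_mono
      (nhdsWithin_le_nhds (s := Ioo g b))
    obtain ⟨w, hw, hw'⟩ := (hev.and self_mem_nhdsWithin).exists
    exact hw (hJ w hw')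
  have hb1 : b < 1 := by
    refine hb1.lt_of_ne ?_
    rintro rfl
    obtain ⟨L, h0, -, hL⟩ := exists_tendsto_orb hε hε hab hJ (right_mem_Icc.2 hab.le) one_pos
    refine (hL 0 hm).1 ?_
    rw [h0, epow]
    split_ifs <;> norm_num
  have hg0 := g_pos
  obtain ⟨F, hF, hFa⟩ := endpoint_cases hε hab hJ (left_mem_Icc.2 hab.le) hga (hab.trans hb1) ha
  obtain ⟨G, hG, hGb⟩ := endpoint_cases hε hab hJ (right_mem_Icc.2 hab.le) (hga.trans hab) hb1 hb
  refine ⟨a, b, hga, haz, hzb, hb1, hJ, ha, hb, ?_⟩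
  have hzJ : z ∈ Ioo a b := ⟨haz, hzb⟩
  have hzx := h.exceeds
  have hzz := (h.admissible.orb_mem hε m).2
  have hida : Tendsto (fun w : ℝ => w) (nhdsWithin a (Ioo a b)) (nhds a) :=
    tendsto_id.mono_left nhdsWithin_le_nhds
  have hidb : Tendsto (fun w : ℝ => w) (nhdsWithin b (Ioo a b)) (nhds b) :=
    tendsto_id.mono_left nhdsWithin_le_nhds
  have hsa : z - a ≤ (-1) ^ m * ε * (orb ε z m - F) := by
    refine le_of_tendsto_of_tendsto (hida.const_sub z) ((hF.const_sub _).const_mul _) ?_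
    filter_upwards [self_mem_nhdsWithin,
      nhdsWithin_le_nhds (Iio_mem_nhds haz)] with w hw hwz
    exact le_orb_sub_orb hε hε hJ hw hzJ hwz le_rfl
  have hsb : b - z ≤ (-1) ^ m * ε * (G - orb ε z m) := by
    refine le_of_tendsto_of_tendsto (hidb.sub_const z) ((hG.sub_const _).const_mul _) ?_
    filter_upwards [self_mem_nhdsWithin,
      nhdsWithin_le_nhds (Ioi_mem_nhds hzb)] with w hw hwz
    exact le_orb_sub_orb hε hε hJ hzJ hw hwz le_rfl
  have hd1 : 1 / (b + 1) < 1 / (z + 1) :=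
    one_div_lt_one_div_of_lt (by linarith) (by linarith)
  have hd2 : 1 / (a + 1) < 1 / (z + 1) + (z - a) := by
    have h1 : 0 < a + 1 := by linarith
    have h2 : 0 < z + 1 := by linarith
    have h3 : 1 / (a + 1) - 1 / (z + 1) = (z - a) / ((a + 1) * (z + 1)) := by
      field_simp
      ring
    have h4 : (z - a) / ((a + 1) * (z + 1)) < z - a := by
      rw [div_lt_iff₀ (by positivity)]
      exact lt_mul_of_one_lt_right (sub_pos.2 haz) (by nlinarith)
    linarith
  have hsign : (-1) ^ m * ε = 1 ∨ (-1) ^ m * ε = -1 := by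
    rcases hε with rfl | rfl <;> rcases neg_one_pow_eq_or ℤ m with h' | h' <;> simp [h']
  rcases hsign with hs | hs
  · have hs' : (-1 : ℝ) ^ m * ε = 1 := by exact_mod_cast hs
    rw [hs'] at hsa hsb
    refine Or.inl ⟨hs, ?_, ?_⟩
    · rcases hFa with hFa | ⟨-, h1, h2⟩
      · linarith
      · exact ⟨h2, h1⟩
    · rcases hGb with hGb | ⟨h0, -, -⟩
      · rwa [hGb] at hG
      · linarith
  · have hs' : (-1 : ℝ) ^ m * ε = -1 := by exact_mod_cast hs
    rw [hs'] at hsa hsb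
    refine Or.inr ⟨hs, ?_, ?_⟩
    · rcases hGb with hGb | ⟨-, h1, h2⟩
      · linarith
      · exact ⟨h2, h1⟩
    · rcases hFa with hFa | ⟨h0, -, -⟩
      · rwa [hFa] at hF
      · linarith

/-! ### Failure of matching when the threshold is hit -/

theorem orb_one_one_ne {e : ℝ} (hz : Admissible e) (h : orb (-1) e 1 ≤ 1 / (e + 1)) :
    orb 1 e 1 ≠ 1 / e - 1 := by
  intro he
  have h0 := hz.pos
  have h1 := hz.lt_one
  have hx0 : e - 1 ≠ 0 := by linarith
  have hy0 := hz.inv_sub_one_pos.ne'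
  have hinv : 1 / (1 / e - 1) = e / (1 - e) := by
    rw [div_sub_one h0.ne', one_div_div]
  have h1e : 1 - e ≠ 0 := by linarith
  have hsum := T_add_T hz.half_lt h1.le hx0 hy0 (-1) (by
    rw [hinv]
    push_cast
    field_simp
    ring)
  have hy := (hz.orb_mem (Or.inr rfl : (-1 : ℤ) = 1 ∨ (-1 : ℤ) = -1) 1).1
  rw [orb_succ, orb_neg_one_zero] at h hy
  rw [orb_succ, orb_one_zero] at he
  rw [he] at hsum
  rcases hsum with hsum | hsum
  · have h2 : 1 / e ≤ 2 - e := by linarith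
    rw [div_le_iff₀ h0] at h2
    nlinarith [sq_nonneg (1 - e), mul_self_pos.2 h1e]
  · have h2 : 2 - 1 / e ≤ 1 / (e + 1) := by linarith
    have h3 : 2 * e ^ 2 ≤ 1 := by
      have h4 : 2 - 1 / e = (2 * e - 1) / e := by
        field_simp
      rw [h4, div_le_div_iff₀ h0 (by linarith)] at h2
      nlinarith
    obtain ⟨k, hk⟩ := exists_T_eq (z := e) hx0
    have h5 : 1 = e * (1 - e) * ((1 - k : ℤ) : ℝ) := by
      rw [he] at hk
      push_cast
      field_simp at hk
      linear_combination -hk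
    have hp : 0 < e * (1 - e) := mul_pos h0 (by linarith)
    have h6 : (4 : ℝ) < ((1 - k : ℤ) : ℝ) := by
      by_contra! hc
      nlinarith [mul_pos (sub_pos.2 hz.half_lt) (sub_pos.2 hz.half_lt)]
    have h7 : ((1 - k : ℤ) : ℝ) < 5 := by
      by_contra! hc
      have h8 : e < 71 / 100 := by nlinarith
      have h9 : 1 / 5 < e * (1 - e) := by
        nlinarith [mul_pos (sub_pos.2 hz.half_lt) (sub_pos.2 h8)]
      nlinarith
    have h8 : 4 < 1 - k := by exact_mod_cast h6
    have h9 : 1 - k < 5 := by exact_mod_cast h7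
    omega

theorem HitsThreshold.not_matching {m : ℕ} {ε : ℤ} {e : ℝ} (hε : ε = 1 ∨ ε = -1) (hm : 0 < m)
    (hz : Admissible e) (h : HitsThreshold m ε e) : orb ε e (m + 2) ≠ orb (-ε) e (m + 1) := by
  have hsum := (h.below.linked hz hε).add_eq_one hz (hz.orb_mem (neg_eq_one_or hε) m).1 h.eq.ge
  have hp := hz.pos
  have hy : orb (-ε) e m = e / (e + 1) := by
    rw [h.eq] at hsum
    field_simp at hsum ⊢
    linarith
  have hle : e / (e + 1) ≤ 1 / (e + 1) := by
    gcongr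
    exact hz.lt_one.le
  have h1 : orb (-1) e 1 ≤ 1 / (e + 1) := by
    rcases Nat.lt_or_ge 1 m with hm' | hm'
    · exact h.below.le hm' (Or.inr rfl)
    · obtain rfl : m = 1 := by omega
      rcases hε with rfl | rfl
      · exact hy.le.trans hle
      · exact h.eq.le
  rw [orb_succ, orb_succ, orb_succ, h.eq, hy, T_one_div_add_one hz, T_div_add_one hz,
    ← orb_one_zero, ← orb_succ]
  exact orb_one_one_ne hz h1

/-! ### Maximality -/

theorem exists_firstExceeds_of_matching {m : ℕ} {ε : ℤ} (hε : ε = 1 ∨ ε = -1) {c d : ℝ}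
    (hc : g ≤ c) (hcd : c < d) (hd : d ≤ 1)
    (h : ∀ z ∈ Ioo c d, orb ε z (m + 2) = orb (-ε) z (m + 1))
    (hne : ∀ᵐ z ∂(volume.restrict (Ioo c d)), orb ε z (m + 1) ≠ orb (-ε) z m) :
    ∃ z ∈ Ioo c d, FirstExceeds m ε z := by
  have hvol : (ae (volume.restrict (Ioo c d))).NeBot := by
    rw [ae_restrict_neBot, Real.volume_Ioo]
    simpa using hcd
  have htr : ∀ᵐ z ∂(volume.restrict (Ioo c d)), Transcendental ℚ z :=
    ae_restrict_of_ae ((Algebraic.countable ℚ ℝ).ae_notMem volume)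
  obtain ⟨z, ⟨hz, ht⟩, hzJ⟩ := ((hne.and htr).and (ae_restrict_mem measurableSet_Ioo)).exists
  exact ⟨z, hzJ, firstExceeds_of_matching (hc.trans_lt hzJ.1) (hzJ.2.trans_le hd) ht hε
    (h z hzJ) hz⟩

theorem HitsThreshold.not_mem {m : ℕ} {ε : ℤ} (hε : ε = 1 ∨ ε = -1) (hm : 0 < m) {a b e : ℝ}
    (h : ∀ z ∈ Ioo a b, Admissible z → orb ε z (m + 2) = orb (-ε) z (m + 1))
    (hg : g < e) (h1 : e < 1) (he : HitsThreshold m ε e) : e ∉ Ioo a b := fun hJ =>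
  he.not_matching hε hm (admissible_of_g_lt hg h1) (h e hJ (admissible_of_g_lt hg h1))

/-- A matching interval cannot extend beyond a component of the set of exceeding parameters. -/
theorem matching_subset_component {m : ℕ} {ε : ℤ} (hε : ε = 1 ∨ ε = -1) (hm : 0 < m)
    {a b a' b' : ℝ} (hga : g < a) (hb1 : b < 1) (hab : a < b)
    (ha : ¬FirstExceeds m ε a) (hb : ¬FirstExceeds m ε b)
    (hcase : ((-1) ^ m * ε = 1 ∧ HitsThreshold m ε a) ∨ ((-1) ^ m * ε = -1 ∧ HitsThreshold m ε b))
    (haa : a' ≤ a) (hbb : b ≤ b') (hb'1 : b' ≤ 1)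
    (h : ∀ z ∈ Ioo a' b', Admissible z → orb ε z (m + 2) = orb (-ε) z (m + 1))
    (hne : ∀ᵐ z ∂(volume.restrict (Ioo a' b')),
      Admissible z → orb ε z (m + 1) ≠ orb (-ε) z m) :
    a' = a ∧ b' = b := by
  have key : ∀ c d, g ≤ c → c < d → Ioo c d ⊆ Ioo a' b' → d ≤ 1 →
      ∃ z ∈ Ioo c d, FirstExceeds m ε z := by
    intro c d hc hcd hsub hd
    have hadm : ∀ z ∈ Ioo c d, Admissible z := fun z hz =>
      admissible_of_g_lt (hc.trans_lt hz.1) (hz.2.trans_le hd)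
    refine exists_firstExceeds_of_matching hε hc hcd hd
      (fun z hz => h z (hsub hz) (hadm z hz)) ?_
    filter_upwards [ae_restrict_of_ae_restrict_of_subset hsub hne,
      ae_restrict_mem measurableSet_Ioo] with z hz hzJ
    exact hz (hadm z hzJ)
  rcases hcase with ⟨hs, hthr⟩ | ⟨hs, hthr⟩
  · have haeq : a' = a := by
      refine haa.eq_of_not_lt fun hlt => ?_
      exact HitsThreshold.not_mem hε hm h hga (hab.trans hb1) hthr ⟨hlt, hab.trans_le hbb⟩
    refine ⟨haeq, (hbb.eq_of_not_lt fun hlt => ?_).symm⟩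
    obtain ⟨z, hz, hzF⟩ := key b b' (hga.trans hab).le hlt (Ioo_subset_Ioo_left (by linarith)) hb'1
    obtain ⟨c, d, hgc, hcz, hzd, hd1, hcd, -, -, h'⟩ := hzF.exists_component hε
    rcases h' with ⟨-, hthr', -⟩ | ⟨hs', -⟩
    · have hbc : b ≤ c := not_lt.1 fun hcb => hb (hcd b ⟨hcb, hz.1.trans hzd⟩)
      exact HitsThreshold.not_mem hε hm h hgc (by linarith) hthr'
        ⟨by linarith, hcz.trans hz.2⟩
    · omega
  · have hbeq : b' = b := by
      refine (hbb.eq_of_not_lt fun hlt => ?_).symm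
      exact HitsThreshold.not_mem hε hm h (hga.trans hab) hb1 hthr ⟨haa.trans_lt hab, hlt⟩
    refine ⟨haa.eq_of_not_lt fun hlt => ?_, hbeq⟩
    obtain ⟨z, hz, hzF⟩ := key (max a' g) a (le_max_right _ _) (max_lt hlt hga)
      (Ioo_subset_Ioo (le_max_left _ _) (by linarith)) (by linarith)
    obtain ⟨c, d, hgc, hcz, hzd, hd1, hcd, -, -, h'⟩ := hzF.exists_component hε
    rcases h' with ⟨hs', -⟩ | ⟨-, hthr', -⟩
    · omega
    · have hda : d ≤ a := not_lt.1 fun had => ha (hcd a ⟨hcz.trans hz.2, had⟩)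
      exact HitsThreshold.not_mem hε hm h (by linarith [hzF.g_lt]) hd1 hthr'
        ⟨by linarith [le_max_left a' g, hz.1], by linarith⟩

/-! ### Matching exponents -/

theorem T_iterate_succ_self {z : ℝ} (hz : Admissible z) (n : ℕ) :
    (T z)^[n + 1] z = orb (-1) z n := by
  have h : T z z = 1 / z - 1 := by
    have h := T_eq (z := z) (k := 1) hz.pos.ne'
    push_cast at h
    exact h (by linarith [hz.inv_sub_one_pos, hz.lt_one])
      (hz.inv_sub_one_lt.trans hz.one_div_lt)
  rw [Function.iterate_succ_apply, h, orb, epow, if_neg (by decide)]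

theorem T_iterate_sub_one (z : ℝ) (n : ℕ) : (T z)^[n] (z - 1) = orb 1 z n := by
  simp [orb, epow]

theorem exists_exponents (m : ℕ) {ε : ℤ} (hε : ε = 1 ∨ ε = -1) :
    ∃ M N : ℕ, (M : ℤ) = m + 2 - (1 - ε) / 2 ∧ (N : ℤ) = m + 2 + (1 - ε) / 2 ∧
      ∀ z, Admissible z →
        (((T z)^[M] (z - 1) = (T z)^[N] z ↔ orb ε z (m + 2) = orb (-ε) z (m + 1)) ∧
        ((T z)^[M - 1] (z - 1) = (T z)^[N - 1] z ↔ orb ε z (m + 1) = orb (-ε) z m)) := by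
  rcases hε with rfl | rfl
  · refine ⟨m + 2, m + 2, by norm_num, by norm_num, fun z hz => ?_⟩
    simp only [T_iterate_sub_one, T_iterate_succ_self hz, Nat.add_succ_sub_one, and_self]
  · refine ⟨m + 1, m + 3, by norm_num; ring, by norm_num; ring, fun z hz => ?_⟩
    simp only [T_iterate_sub_one, T_iterate_succ_self hz, Nat.add_succ_sub_one, add_zero, neg_neg]
    exact ⟨eq_comm, eq_comm⟩

theorem FirstExceeds.iterate_ne {m : ℕ} {ε : ℤ} {z : ℝ} (hε : ε = 1 ∨ ε = -1)
    (h : FirstExceeds m ε z) {M N : ℕ} (hM : (M : ℤ) = m + 2 - (1 - ε) / 2)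
    (hN : (N : ℤ) = m + 2 + (1 - ε) / 2) :
    (∀ n, 1 ≤ n → n < N → (T z)^[n] z ≠ z - 1) ∧
      (∀ n, 1 ≤ n → n < M → (T z)^[n] (z - 1) ≠ z - 1) := by
  have hz := h.admissible
  have hlast : orb ε z (m + 1) ≠ z - 1 := by linarith [(h.matching hε).2.2, hz.lt_one]
  constructor
  · intro n h1 hn
    obtain ⟨n, rfl⟩ := Nat.exists_eq_add_of_le' h1
    rw [T_iterate_succ_self hz]
    rcases Nat.eq_zero_or_pos n with rfl | h0
    · rw [orb_neg_one_zero]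
      linarith [hz.inv_sub_one_pos, hz.lt_one]
    · rcases Nat.lt_or_ge m n with hnm | hnm
      · obtain rfl : ε = -1 := by omega
        obtain rfl : n = m + 1 := by omega
        exact hlast
      · exact h.orb_ne_sub_one hε (Or.inr rfl) h0 hnm
  · intro n h1 hn
    rw [T_iterate_sub_one]
    rcases Nat.lt_or_ge m n with hnm | hnm
    · obtain rfl : ε = 1 := by omega
      obtain rfl : n = m + 1 := by omega
      exact hlast
    · exact h.orb_ne_sub_one hε (Or.inl rfl) h1 hnm

theorem FirstExceeds.not_mem_Etilde {m : ℕ} {ε : ℤ} {z : ℝ} (hε : ε = 1 ∨ ε = -1)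
    (h : FirstExceeds m ε z) : z ∉ Etilde := by
  intro hE
  have hE := hE.2 m (h.pos hε)
  have hx := h.exceeds
  rcases hε with rfl | rfl
  · rw [T_iterate_sub_one] at hE
    exact hx.not_ge hE.1
  · exact hx.not_ge (by simpa [orb, epow] using hE.2)

theorem below_iff_iterate_le {z : ℝ} {m : ℕ} : Below z m ↔
    ∀ n < m, (T z)^[n] (z - 1) ≤ 1 / (z + 1) ∧ (T z)^[n] (1 / z - 1) ≤ 1 / (z + 1) := by
  simp [Below, orb, epow]

/-- Components of the set of exceeding parameters are matching intervals. -/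
theorem isMatchingInterval_component {m : ℕ} {ε : ℤ} (hε : ε = 1 ∨ ε = -1) (hm : 0 < m)
    {a b : ℝ} (hga : g < a) (hb1 : b < 1) (hab : a < b)
    (hJ : ∀ z ∈ Ioo a b, FirstExceeds m ε z)
    (ha : ¬FirstExceeds m ε a) (hb : ¬FirstExceeds m ε b)
    (hcase : ((-1) ^ m * ε = 1 ∧ HitsThreshold m ε a) ∨ ((-1) ^ m * ε = -1 ∧ HitsThreshold m ε b))
    {M N : ℕ} (hMN : ∀ z, Admissible z →
        (((T z)^[M] (z - 1) = (T z)^[N] z ↔ orb ε z (m + 2) = orb (-ε) z (m + 1)) ∧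
        ((T z)^[M - 1] (z - 1) = (T z)^[N - 1] z ↔ orb ε z (m + 1) = orb (-ε) z m))) :
    IsMatchingInterval (Ioo a b) M N := by
  have hg0 := g_pos
  refine ⟨⟨a, b, hab, rfl⟩, fun z hz => ⟨by linarith [hz.1], by linarith [hz.2]⟩, ?_, ?_, ?_⟩
  · intro z hz
    exact (hMN z (hJ z hz).admissible).1.2 ((hJ z hz).matching hε).1
  · filter_upwards [ae_restrict_mem measurableSet_Ioo] with z hz
    exact fun h => ((hJ z hz).matching hε).2.1 ((hMN z (hJ z hz).admissible).2.1 h)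
  · rintro _ ⟨a', b', hab', rfl⟩ h01 hmat hne hsub
    have hcl := closure_minimal h01 isClosed_Icc
    rw [closure_Ioo hab'.ne] at hcl
    have hb'1 : b' ≤ 1 := (hcl (right_mem_Icc.2 hab'.le)).2
    obtain ⟨haa, hbb⟩ := (Ioo_subset_Ioo_iff hab).1 hsub
    obtain ⟨rfl, rfl⟩ := matching_subset_component hε hm hga hb1 hab ha hb hcase haa hbb hb'1
      (fun z hz hza => (hMN z hza).1.1 (hmat z hz))
      (by
        filter_upwards [hne] with z hz hza h
        exact hz ((hMN z hza).2.2 h))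
    rfl

theorem stmt4 (α : ℝ) (hα : α ∈ Set.Ioc g 1) (m : ℕ) (ε : ℤ) (hε : ε = -1 ∨ ε = 1)
    (h1 : ∀ n < m, (T α)^[n] (α - 1) ≤ 1 / (α + 1) ∧ (T α)^[n] (1 / α - 1) ≤ 1 / (α + 1))
    (h2 : 1 / (α + 1) < (T α)^[m] (epow ε α)) :
    ∃ (J : Set ℝ) (M N : ℕ) (α₁ α₂ : ℝ),
      IsMatchingInterval J M N ∧ α ∈ J ∧
      (M : ℤ) = m + 2 - (1 - ε) / 2 ∧ (N : ℤ) = m + 2 + (1 - ε) / 2 ∧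
      (∀ α' ∈ J,
        (∀ n < m, (T α')^[n] (α' - 1) ≤ 1 / (α' + 1) ∧
          (T α')^[n] (1 / α' - 1) ≤ 1 / (α' + 1)) ∧
        1 / (α' + 1) < (T α')^[m] (epow ε α')) ∧
      Etilde ∩ J = ∅ ∧
      (J = Set.Ioo α₁ α₂ ∨ J = Set.Ioo α₂ α₁) ∧
      (T α₁)^[m] (epow ε α₁) = 1 / (α₁ + 1) ∧
      Filter.Tendsto (fun z => (T z)^[m] (epow ε z)) (nhdsWithin α₂ J) (nhds α₂) ∧
      (∀ α' ∈ J, (∀ n, 1 ≤ n → n < N → (T α')^[n] α' ≠ α' - 1) ∧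
        (∀ n, 1 ≤ n → n < M → (T α')^[n] (α' - 1) ≠ α' - 1)) := by
  have hε' : ε = 1 ∨ ε = -1 := hε.symm
  have hα1 : α < 1 := by
    refine hα.2.lt_of_ne ?_
    rintro rfl
    have h0 : epow ε 1 = 0 := by
      rw [epow]
      split_ifs <;> norm_num
    have h3 := orb_eq_zero_of_le (δ := ε) (z := 1) (n := 0) (m := m) h0 m.zero_le
    rw [orb] at h3
    rw [h3] at h2
    norm_num at h2
  have hF : FirstExceeds m ε α := ⟨hα.1, hα1, below_iff_iterate_le.2 h1, h2⟩
  have hm := hF.pos hε'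
  obtain ⟨a, b, hga, haα, hαb, hb1, hJ, ha, hb, hcase⟩ := hF.exists_component hε'
  have hab := haα.trans hαb
  obtain ⟨M, N, hM, hN, hMN⟩ := exists_exponents m hε'
  have hmat : IsMatchingInterval (Ioo a b) M N :=
    isMatchingInterval_component hε' hm hga hb1 hab hJ ha hb
      (hcase.imp (fun h => ⟨h.1, h.2.1⟩) fun h => ⟨h.1, h.2.1⟩) hMN
  have hE : Etilde ∩ Ioo a b = ∅ :=
    eq_empty_of_forall_notMem fun z hz => (hJ z hz.2).not_mem_Etilde hε' hz.1
  have hJ' : ∀ α' ∈ Ioo a b,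
      (∀ n < m, (T α')^[n] (α' - 1) ≤ 1 / (α' + 1) ∧
        (T α')^[n] (1 / α' - 1) ≤ 1 / (α' + 1)) ∧
      1 / (α' + 1) < (T α')^[m] (epow ε α') := fun z hz =>
    ⟨below_iff_iterate_le.1 (hJ z hz).below, (hJ z hz).exceeds⟩
  have hit := fun z hz => (hJ z hz).iterate_ne hε' hM hN
  rcases hcase with ⟨-, hthr, hlim⟩ | ⟨-, hthr, hlim⟩
  · exact ⟨Ioo a b, M, N, a, b, hmat, ⟨haα, hαb⟩, hM, hN, hJ', hE, Or.inl rfl, hthr.eq, hlim, hit⟩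
  · exact ⟨Ioo a b, M, N, b, a, hmat, ⟨haα, hαb⟩, hM, hN, hJ', hE, Or.inr rfl, hthr.eq, hlim, hit⟩
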